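/- Let R be an integral domain and let C̃ and C̃' be S-complexes over R. Then, under the ring multiplication of R[[x⁻¹, x]], one has the inclusion 𝔍(C̃)·𝔍(C̃') ⊆ 𝔍(C̃ ⊗ C̃'). -/

import Mathlib

/-!  S-complexes over a commutative ring `R` (following Daemi–Scaduto).

An S-complex is a ℤ-graded finitely generated free chain complex
`C̃ = C ⊕ C[1] ⊕ R` determined by the data of `C` together with maps
`d, v, δ₁, δ₂`.  We encode the graded module `C` by a single module `Tot`
together with an internal ℤ-grading by submodules, and we carry the sign
map `ε` (multiplication by `(-1)^i` on the degree `i` part) as data. -/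

universe u

/-- The data of an S-complex over `R`: a module `Tot` (the total module of the
ℤ-graded module `C_*`), its grading, the sign map `ε`, and the structure maps
`d : C_* → C_{*-1}`, `v : C_* → C_{*-2}`, `δ₁ : C_* → R` (supported in degree 1),
`δ₂ : R → C_{-2}`. -/
structure SComplexData (R : Type u) [CommRing R] where
  Tot : Type u
  [acg : AddCommGroup Tot]
  [mod : Module R Tot]
  grading : ℤ → Submodule R Tot
  sign : Tot →ₗ[R] Tot
  d : Tot →ₗ[R] Tot
  v : Tot →ₗ[R] Tot
  δ₁ : Tot →ₗ[R] R
  δ₂ : R →ₗ[R] Tot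

attribute [instance] SComplexData.acg SComplexData.mod

namespace SComplexData

variable {R : Type u} [CommRing R]

/-- The axioms making the data of `X : SComplexData R` into a genuine S-complex:
the grading is an internal direct sum decomposition into finitely generated free
pieces, the sign map is `(-1)^i` on the degree `i` piece, the structure maps are
graded of the appropriate degrees (`δ₁` supported on `C_1`, `δ₂` valued in `C_{-2}`),
and the S-complex relations `d∘d = 0`, `δ₁∘d = 0`, `d∘δ₂ = 0`,
`d∘v − v∘d − δ₂∘δ₁ = 0` hold; the latter are equivalent to `d̃ ∘ d̃ = 0` for the
differential `d̃(α, β, r) = (dα, vα − dβ + δ₂ r, δ₁ α)` on `C̃ = C ⊕ C[1] ⊕ R`. -/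
structure IsSComplex (X : SComplexData R) : Prop where
  internal : DirectSum.IsInternal X.grading
  free : ∀ i : ℤ, Module.Free R ↥(X.grading i)
  finite : Module.Finite R X.Tot
  sign_spec : ∀ i : ℤ, ∀ x ∈ X.grading i, X.sign x = if Even i then x else -x
  d_deg : ∀ i : ℤ, (X.grading i).map X.d ≤ X.grading (i - 1)
  v_deg : ∀ i : ℤ, (X.grading i).map X.v ≤ X.grading (i - 2)
  δ₁_deg : ∀ i : ℤ, i ≠ 1 → ∀ x ∈ X.grading i, X.δ₁ x = 0
  δ₂_deg : LinearMap.range X.δ₂ ≤ X.grading (-2)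
  d_d : X.d ∘ₗ X.d = 0
  δ₁_d : X.δ₁ ∘ₗ X.d = 0
  d_δ₂ : X.d ∘ₗ X.δ₂ = 0
  d_v : X.d ∘ₗ X.v - X.v ∘ₗ X.d - X.δ₂ ∘ₗ X.δ₁ = 0

/-- A morphism of S-complexes `λ̃ : C̃ → C̃'`, i.e. a degree-0 chain map
`λ̃(α, β, r) = (λ α, μ α + λ β + Δ₂ r, Δ₁ α + r)`, recorded through its
components `λ, μ, Δ₁, Δ₂` (here `l` stands for `λ`). -/
structure SMorphism (X Y : SComplexData R) where
  l : X.Tot →ₗ[R] Y.Tot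
  μ : X.Tot →ₗ[R] Y.Tot
  Δ₁ : X.Tot →ₗ[R] R
  Δ₂ : R →ₗ[R] Y.Tot
  l_deg : ∀ i : ℤ, (X.grading i).map l ≤ Y.grading i
  μ_deg : ∀ i : ℤ, (X.grading i).map μ ≤ Y.grading (i - 1)
  Δ₁_deg : ∀ i : ℤ, i ≠ 0 → ∀ x ∈ X.grading i, Δ₁ x = 0
  Δ₂_deg : LinearMap.range Δ₂ ≤ Y.grading (-1)
  comm_d : l ∘ₗ X.d = Y.d ∘ₗ l
  comm_δ₁ : Δ₁ ∘ₗ X.d + X.δ₁ = Y.δ₁ ∘ₗ l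
  comm_δ₂ : Y.d ∘ₗ Δ₂ + l ∘ₗ X.δ₂ = Y.δ₂
  comm_v : μ ∘ₗ X.d + Y.d ∘ₗ μ + l ∘ₗ X.v - Y.v ∘ₗ l + Δ₂ ∘ₗ X.δ₁ - Y.δ₂ ∘ₗ Δ₁ = 0

end SComplexData

/-- Functions `ℕ → M` with finitely many nonzero values (i.e. support bounded
above); this realizes the polynomial module `M[x]`. -/
def NatBdd (R : Type u) [CommRing R] (M : Type u) [AddCommGroup M] [Module R M] :
    Submodule R (ℕ → M) where
  carrier := {f | ∃ N : ℕ, ∀ n : ℕ, N < n → f n = 0}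
  add_mem' := by
    rintro f g ⟨N, hN⟩ ⟨K, hK⟩
    refine ⟨max N K, fun n hn => ?_⟩
    have h1 := hN n (lt_of_le_of_lt (le_max_left N K) hn)
    have h2 := hK n (lt_of_le_of_lt (le_max_right N K) hn)
    show f n + g n = 0
    rw [h1, h2, add_zero]
  zero_mem' := ⟨0, fun _ _ => rfl⟩
  smul_mem' := by
    rintro c f ⟨N, hN⟩
    refine ⟨N, fun n hn => ?_⟩
    show c • f n = 0
    rw [hN n hn, smul_zero]

/-- Functions `ℤ → M` with support bounded above; for `M = R` this realizes the
ring `R[[x⁻¹, x]]` of Laurent series with finitely many positive powers of `x`. -/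
def IntBdd (R : Type u) [CommRing R] (M : Type u) [AddCommGroup M] [Module R M] :
    Submodule R (ℤ → M) where
  carrier := {f | ∃ N : ℤ, ∀ n : ℤ, N < n → f n = 0}
  add_mem' := by
    rintro f g ⟨N, hN⟩ ⟨K, hK⟩
    refine ⟨max N K, fun n hn => ?_⟩
    have h1 := hN n (lt_of_le_of_lt (le_max_left N K) hn)
    have h2 := hK n (lt_of_le_of_lt (le_max_right N K) hn)
    show f n + g n = 0
    rw [h1, h2, add_zero]
  zero_mem' := ⟨0, fun _ _ => rfl⟩
  smul_mem' := by
    rintro c f ⟨N, hN⟩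
    refine ⟨N, fun n hn => ?_⟩
    show c • f n = 0
    rw [hN n hn, smul_zero]

/-- The multiplication of `R[[x⁻¹, x]]`, realized as a convolution product on
functions `ℤ → R` with support bounded above. -/
noncomputable def lmul {R : Type u} [CommRing R] (f g : ↥(IntBdd R R)) : ↥(IntBdd R R) :=
  ⟨fun n => ∑ᶠ i : ℤ, f.1 i * g.1 (n - i), by
    obtain ⟨N, hN⟩ := f.2
    obtain ⟨K, hK⟩ := g.2
    refine ⟨N + K, fun n hn => ?_⟩
    apply finsum_eq_zero_of_forall_eq_zero
    intro i
    by_cases h : N < i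
    · rw [hN i h, zero_mul]
    · rw [hK (n - i) (by omega), mul_zero]⟩

namespace SComplexData

variable {R : Type u} [CommRing R]

/-- The carrier of the small equivariant complex `𝔣Ĉ_* = C_{*-1} ⊕ R[x]`,
with `R[x]` realized as finitely supported functions `ℕ → R`. -/
abbrev Small (X : SComplexData R) : Type u := X.Tot × ↥(NatBdd R R)

/-- `Σᵢ vⁱ δ₂(aᵢ)` for a polynomial with coefficients `aᵢ`. -/
noncomputable def sumV (X : SComplexData R) (f : ↥(NatBdd R R)) : X.Tot :=
  ∑ᶠ i : ℕ, (X.v ^ i) (X.δ₂ (f.1 i))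

/-- The differential `𝔡̂(α, Σᵢ aᵢxⁱ) = (dα − Σᵢ vⁱδ₂(aᵢ), 0)` of the small
equivariant complex. -/
noncomputable def smallD (X : SComplexData R) : X.Small → X.Small :=
  fun z => (X.d z.1 - X.sumV z.2, 0)

/-- The `R[x]`-module structure of the small equivariant complex:
`x · (α, p(x)) = (v(α), δ₁(α) + x·p(x))`; this is the action of `x`. -/
noncomputable def xSmall (X : SComplexData R) : X.Small → X.Small :=
  fun z => (X.v z.1, ⟨fun n => if n = 0 then X.δ₁ z.1 else z.2.1 (n - 1), by
    obtain ⟨N, hN⟩ := z.2.2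
    refine ⟨N + 1, fun n hn => ?_⟩
    show (if n = 0 then X.δ₁ z.1 else z.2.1 (n - 1)) = 0
    rw [if_neg (by omega)]
    exact hN (n - 1) (by omega)⟩)

/-- The map `𝔦 : 𝔣Ĉ_* → R[[x⁻¹, x]]`,
`𝔦(α, Σᵢ aᵢxⁱ) = Σ_{i ≤ −1} δ₁v^{−i−1}(α) xⁱ + Σᵢ aᵢxⁱ`. -/
noncomputable def iota (X : SComplexData R) : X.Small → ↥(IntBdd R R) :=
  fun z => ⟨fun n => if n < 0 then X.δ₁ ((X.v ^ (-n - 1).toNat) z.1) else z.2.1 n.toNat, by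
    obtain ⟨N, hN⟩ := z.2.2
    refine ⟨(N : ℤ), fun n hn => ?_⟩
    show (if n < 0 then X.δ₁ ((X.v ^ (-n - 1).toNat) z.1) else z.2.1 n.toNat) = 0
    rw [if_neg (by omega)]
    exact hN n.toNat (by omega)⟩

/-- `𝔍(C̃) = 𝔦(ker 𝔡̂)`, an `R[x]`-submodule of `R[[x⁻¹, x]]`, here recorded
as a set. -/
noncomputable def JJ (X : SComplexData R) : Set ↥(IntBdd R R) :=
  X.iota '' {z | X.smallD z = 0}

/-- `DegEq Q n` means that the Laurent series `Q` is nonzero with `Deg Q = n`,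
i.e. `n` is the largest exponent with nonzero coefficient. -/
def DegEq {R : Type u} [CommRing R] (Q : ↥(IntBdd R R)) (n : ℤ) : Prop :=
  Q.1 n ≠ 0 ∧ ∀ m : ℤ, n < m → Q.1 m = 0

/-- The set of degrees of nonzero elements of `𝔍(C̃)`. -/
noncomputable def degSet (X : SComplexData R) : Set ℤ :=
  {n : ℤ | ∃ Q ∈ X.JJ, DegEq Q n}

/-- The Frøyshov invariant `h(C̃) = −inf {Deg Q : 0 ≠ Q ∈ 𝔍(C̃)}`. -/
noncomputable def hInv (X : SComplexData R) : ℤ := -sInf X.degSet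

/-- The ideal `J_i(C̃) = {a ∈ R : ∃ Q = a·x^{−i} + (lower order terms) ∈ 𝔍(C̃)}`,
recorded as a set. -/
noncomputable def Jideal (X : SComplexData R) (i : ℤ) : Set R :=
  {a : R | ∃ Q ∈ X.JJ, (∀ m : ℤ, -i < m → Q.1 m = 0) ∧ Q.1 (-i) = a}

end SComplexData

namespace SComplexData

open TensorProduct

variable {R : Type u} [CommRing R]

/-- The carrier of the tensor product S-complex:
`C^⊗ = (C ⊗ C') ⊕ (C ⊗ C')[1] ⊕ C ⊕ C'`. -/
abbrev TTen (A B : SComplexData R) : Type u :=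
  (A.Tot ⊗[R] B.Tot) × (A.Tot ⊗[R] B.Tot) × A.Tot × B.Tot

/-- Projection onto the first summand `(C ⊗ C')` of `C^⊗`. -/
noncomputable def tp1 (A B : SComplexData R) : TTen A B →ₗ[R] A.Tot ⊗[R] B.Tot :=
  LinearMap.fst R _ _

/-- Projection onto the second summand `(C ⊗ C')[1]` of `C^⊗`. -/
noncomputable def tp2 (A B : SComplexData R) : TTen A B →ₗ[R] A.Tot ⊗[R] B.Tot :=
  (LinearMap.fst R _ _) ∘ₗ (LinearMap.snd R _ _)

/-- Projection onto the third summand `C` of `C^⊗`. -/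
noncomputable def tp3 (A B : SComplexData R) : TTen A B →ₗ[R] A.Tot :=
  (LinearMap.fst R _ _) ∘ₗ (LinearMap.snd R _ _) ∘ₗ (LinearMap.snd R _ _)

/-- Projection onto the fourth summand `C'` of `C^⊗`. -/
noncomputable def tp4 (A B : SComplexData R) : TTen A B →ₗ[R] B.Tot :=
  (LinearMap.snd R _ _) ∘ₗ (LinearMap.snd R _ _) ∘ₗ (LinearMap.snd R _ _)

/-- The degree `k` piece of the grading of `C ⊗ C'`:
the span of the images of `C_i ⊗ C'_{k-i}`. -/
noncomputable def gradedPiece (A B : SComplexData R) (k : ℤ) :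
    Submodule R (A.Tot ⊗[R] B.Tot) :=
  ⨆ i : ℤ, LinearMap.range
    (TensorProduct.map (A.grading i).subtype (B.grading (k - i)).subtype)

/-- The tensor product S-complex `C̃ ⊗ C̃'` of two S-complexes, with chain module
`C^⊗ = (C ⊗ C') ⊕ (C ⊗ C')[1] ⊕ C ⊕ C'` and the block-matrix structure maps of
Daemi–Scaduto (Section 4.5); `ε` denotes the sign map. -/
noncomputable def tensorS (A B : SComplexData R) : SComplexData R where
  Tot := TTen A B
  grading := fun k =>
    (gradedPiece A B k).prod ((gradedPiece A B (k - 1)).prod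
      ((A.grading k).prod (B.grading k)))
  sign := LinearMap.prod
      ((TensorProduct.map A.sign B.sign) ∘ₗ tp1 A B)
      (LinearMap.prod (-((TensorProduct.map A.sign B.sign) ∘ₗ tp2 A B))
        (LinearMap.prod (A.sign ∘ₗ tp3 A B) (B.sign ∘ₗ tp4 A B)))
  d := LinearMap.prod
      -- row 1 :  (d⊗1 + ε⊗d') x₁
      ((TensorProduct.map A.d LinearMap.id + TensorProduct.map A.sign B.d) ∘ₗ tp1 A B)
      (LinearMap.prod
        -- row 2 : (−εv⊗1 + ε⊗v') x₁ + (d⊗1 − ε⊗d') x₂ + (ε⊗δ₂') x₃ − (δ₂⊗1) x₄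
        ((TensorProduct.map A.sign B.v - TensorProduct.map (A.sign ∘ₗ A.v) LinearMap.id) ∘ₗ tp1 A B
          + (TensorProduct.map A.d LinearMap.id - TensorProduct.map A.sign B.d) ∘ₗ tp2 A B
          + ((TensorProduct.map A.sign B.δ₂) ∘ₗ (TensorProduct.rid R A.Tot).symm.toLinearMap) ∘ₗ tp3 A B
          - ((TensorProduct.map A.δ₂ LinearMap.id) ∘ₗ (TensorProduct.lid R B.Tot).symm.toLinearMap) ∘ₗ tp4 A B)
        (LinearMap.prod
          -- row 3 : (ε⊗δ₁') x₁ + d x₃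
          (((TensorProduct.rid R A.Tot).toLinearMap ∘ₗ TensorProduct.map A.sign B.δ₁) ∘ₗ tp1 A B
            + A.d ∘ₗ tp3 A B)
          -- row 4 : (δ₁⊗1) x₁ + d' x₄
          (((TensorProduct.lid R B.Tot).toLinearMap ∘ₗ TensorProduct.map A.δ₁ LinearMap.id) ∘ₗ tp1 A B
            + B.d ∘ₗ tp4 A B)))
  v := LinearMap.prod
      -- row 1 : (v⊗1) x₁ + (δ₂⊗1) x₄
      ((TensorProduct.map A.v LinearMap.id) ∘ₗ tp1 A B
        + ((TensorProduct.map A.δ₂ LinearMap.id) ∘ₗ (TensorProduct.lid R B.Tot).symm.toLinearMap) ∘ₗ tp4 A B)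
      (LinearMap.prod
        -- row 2 : (v⊗1) x₂
        ((TensorProduct.map A.v LinearMap.id) ∘ₗ tp2 A B)
        (LinearMap.prod
          -- row 3 : v x₃
          (A.v ∘ₗ tp3 A B)
          -- row 4 : (δ₁⊗1) x₂ + v' x₄
          (((TensorProduct.lid R B.Tot).toLinearMap ∘ₗ TensorProduct.map A.δ₁ LinearMap.id) ∘ₗ tp2 A B
            + B.v ∘ₗ tp4 A B)))
  δ₁ := A.δ₁ ∘ₗ tp3 A B + B.δ₁ ∘ₗ tp4 A B
  δ₂ := LinearMap.prod 0 (LinearMap.prod 0 (LinearMap.prod A.δ₂ B.δ₂))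

end SComplexData

open Polynomial in
/-- The linear functional on `R[X]` sending `X ^ n` to `u n`. -/
noncomputable def Polynomial.coeffSum {R M : Type*} [CommRing R] [AddCommGroup M] [Module R M]
    (u : ℕ → M) : R[X] →ₗ[R] M :=
  Polynomial.lsum fun n => LinearMap.toSpanSingleton R M (u n)

namespace Polynomial

variable {R M : Type*} [CommRing R] [AddCommGroup M] [Module R M]

theorem coeffSum_apply (u : ℕ → M) (P : R[X]) :
    coeffSum u P = ∑ n ∈ P.support, P.coeff n • u n := by
  simp [coeffSum, Polynomial.lsum_apply, Polynomial.sum_def]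

@[simp]
theorem coeffSum_X_pow (u : ℕ → M) (n : ℕ) : coeffSum u (X ^ n : R[X]) = u n := by
  simp [coeffSum, Polynomial.lsum_apply, Polynomial.X_pow_eq_monomial, Polynomial.sum_monomial_index]

theorem induction_X_pow {p : R[X] → Prop} (P : R[X]) (add : ∀ P Q, p P → p Q → p (P + Q))
    (smul : ∀ (a : R) P, p P → p (a • P)) (X_pow : ∀ n, p (X ^ n)) : p P := by
  induction P using Polynomial.induction_on' with
  | add P Q hP hQ => exact add P Q hP hQ
  | monomial n a => rw [← smul_X_eq_monomial]; exact smul _ _ (X_pow n)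

section DivDiff

variable {E : Type*} [Ring E] [Algebra R E]

/-- The divided difference `(P(F) - P(G)) / (F - G)` of a polynomial at two elements `F`, `G`. -/
noncomputable def divDiff (F G : E) : R[X] →ₗ[R] E :=
  coeffSum fun n => ∑ i ∈ Finset.range n, F ^ i * G ^ (n - 1 - i)

theorem divDiff_X_pow (F G : E) (n : ℕ) :
    divDiff F G (X ^ n : R[X]) = ∑ i ∈ Finset.range n, F ^ i * G ^ (n - 1 - i) := by
  simp [divDiff]

theorem divDiff_X_mul (F G : E) (P : R[X]) :
    divDiff F G (X * P) = F * divDiff F G P + aeval G P := by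
  induction P using induction_X_pow with
  | add P Q hP hQ => simp only [mul_add, map_add, hP, hQ]; abel
  | smul a P hP => simp only [mul_smul_comm, map_smul, hP, smul_add]
  | X_pow n =>
    rw [← pow_succ', divDiff_X_pow, divDiff_X_pow, Finset.sum_range_succ', Finset.mul_sum]
    simp only [map_pow, aeval_X, pow_zero, one_mul]
    congr 1
    refine Finset.sum_congr rfl fun i _ => ?_
    rw [pow_succ', mul_assoc, show n + 1 - 1 - (i + 1) = n - 1 - i by omega]

@[simp]
theorem divDiff_one (F G : E) : divDiff F G (1 : R[X]) = 0 := by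
  simpa using divDiff_X_pow (R := R) F G 0

theorem divDiff_X_mul' {F G : E} (P : R[X]) :
    divDiff F G (X * P) = divDiff F G P * G + aeval F P := by
  induction P using induction_X_pow with
  | add P Q hP hQ => simp only [mul_add, map_add, hP, hQ, add_mul]; abel
  | smul a P hP => simp only [mul_smul_comm, map_smul, hP, smul_add, smul_mul_assoc]
  | X_pow n =>
    rw [← pow_succ', divDiff_X_pow, divDiff_X_pow, Finset.sum_range_succ, Finset.sum_mul]
    simp only [map_pow, aeval_X]
    congr 1
    · refine Finset.sum_congr rfl fun i hi => ?_
      have := Finset.mem_range.mp hi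
      rw [mul_assoc, ← pow_succ, show n + 1 - 1 - i = n - 1 - i + 1 by omega]
    · simp

theorem divDiff_mul (F G : E) (P Q : R[X]) :
    divDiff F G (P * Q) = divDiff F G P * aeval G Q + aeval F P * divDiff F G Q := by
  induction P using induction_X_pow with
  | add P P' hP hP' => simp only [map_add, hP, hP', add_mul]; abel
  | smul a P hP => simp only [smul_mul_assoc, map_smul, hP, smul_add]
  | X_pow n =>
    induction n with
    | zero => simp
    | succ n ih =>
      rw [pow_succ', mul_assoc, divDiff_X_mul, divDiff_X_mul, ih]
      simp only [map_mul, aeval_X, map_pow]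
      noncomm_ring

theorem sub_mul_divDiff {F G : E} (h : Commute F G) (P : R[X]) :
    (F - G) * divDiff F G P = aeval F P - aeval G P := by
  induction P using induction_X_pow with
  | add P Q hP hQ => simp only [map_add, mul_add, hP, hQ]; abel
  | smul a P hP => simp only [map_smul, mul_smul_comm, hP, smul_sub]
  | X_pow n => simpa [divDiff_X_pow] using h.mul_geom_sum₂ n

theorem commute_divDiff {F G S : E} (hF : Commute S F) (hG : Commute S G) (P : R[X]) :
    Commute S (divDiff F G P) := by
  induction P using induction_X_pow with
  | add P Q hP hQ => rw [map_add]; exact hP.add_right hQ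
  | smul a P hP => rw [map_smul]; exact hP.smul_right a
  | X_pow n =>
    rw [divDiff_X_pow]
    exact Commute.sum_right _ _ _ fun i _ => (hF.pow_right _).mul_right (hG.pow_right _)

end DivDiff

/-- The polynomial part of the product of `P` with `∑ₗ cₗ x ^ (-l - 1)`. -/
noncomputable def polyPart (c : ℕ → R) : R[X] →ₗ[R] R[X] :=
  coeffSum fun n => ∑ l ∈ Finset.range n, c l • X ^ (n - 1 - l)

theorem polyPart_X_pow (c : ℕ → R) (n : ℕ) :
    polyPart c (X ^ n) = ∑ l ∈ Finset.range n, c l • X ^ (n - 1 - l) := by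
  simp [polyPart]

@[simp]
theorem polyPart_one (c : ℕ → R) : polyPart c 1 = 0 := by
  simpa using polyPart_X_pow c 0

theorem polyPart_X_pow_succ (c : ℕ → R) (n : ℕ) :
    polyPart c (X ^ (n + 1)) = X * polyPart c (X ^ n) + c n • 1 := by
  rw [polyPart_X_pow, polyPart_X_pow, Finset.sum_range_succ, Finset.mul_sum]
  congr 1
  · refine Finset.sum_congr rfl fun i hi => ?_
    have := Finset.mem_range.mp hi
    rw [mul_smul_comm, ← pow_succ', show n + 1 - 1 - i = n - 1 - i + 1 by omega]
  · simp

theorem coeff_polyPart_X_pow (c : ℕ → R) (n m : ℕ) :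
    (polyPart c (X ^ n)).coeff m = if m < n then c (n - 1 - m) else 0 := by
  rw [polyPart_X_pow, finsetSum_coeff]
  simp only [coeff_smul, coeff_X_pow, smul_eq_mul, mul_ite, mul_one, mul_zero]
  split_ifs with h
  · rw [Finset.sum_eq_single (n - 1 - m)]
    · rw [if_pos (by omega)]
    · intro b hb hne
      have := Finset.mem_range.mp hb
      rw [if_neg (by omega)]
    · intro hb
      exact absurd (Finset.mem_range.mpr (by omega)) hb
  · refine Finset.sum_eq_zero fun b hb => ?_
    have := Finset.mem_range.mp hb
    rw [if_neg (by omega)]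

section

variable {E : Type*} [Ring E] [Algebra R E]

theorem divDiff_polyPart_X_pow (F G : E) (c : ℕ → R) (n : ℕ) :
    divDiff F G (polyPart c (X ^ n)) =
      ∑ i ∈ Finset.range n, F ^ i * aeval G (polyPart c (X ^ (n - 1 - i))) := by
  induction n with
  | zero => simp
  | succ n ih =>
    rw [polyPart_X_pow_succ, map_add, divDiff_X_mul, map_smul, divDiff_one, smul_zero, add_zero, ih,
      Finset.sum_range_succ', Finset.mul_sum]
    simp only [pow_zero, one_mul]
    congr 1
    refine Finset.sum_congr rfl fun i _ => ?_
    rw [pow_succ', mul_assoc, show n + 1 - 1 - (i + 1) = n - 1 - i by omega]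

theorem divDiff_polyPart_X_pow' (F G : E) (c : ℕ → R) (n : ℕ) :
    divDiff F G (polyPart c (X ^ n)) =
      ∑ i ∈ Finset.range n, aeval F (polyPart c (X ^ i)) * G ^ (n - 1 - i) := by
  induction n with
  | zero => simp
  | succ n ih =>
    rw [polyPart_X_pow_succ, map_add, divDiff_X_mul', map_smul, divDiff_one, smul_zero, add_zero,
      ih, Finset.sum_range_succ, Finset.sum_mul]
    congr 1
    · refine Finset.sum_congr rfl fun i hi => ?_
      have := Finset.mem_range.mp hi
      rw [mul_assoc, ← pow_succ, show n + 1 - 1 - i = n - 1 - i + 1 by omega]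
    · simp

end

end Polynomial

section Laurent

open Polynomial

variable {R : Type u} [CommRing R]

theorem finsum_mul_eq_coeffSum {f : ℤ → R} {P : R[X]} (hpos : ∀ n : ℕ, f n = P.coeff n)
    (hneg : ∀ n < 0, f n = 0) (g : ℤ → R) (n : ℤ) :
    ∑ᶠ i : ℤ, f i * g (n - i) = coeffSum (fun i : ℕ => g (n - i)) P := by
  rw [finsum_eq_sum_of_support_subset (s := P.support.map Nat.castEmbedding), coeffSum_apply,
    Finset.sum_map]
  · simp [hpos]
  · intro i hi
    have hfi : f i ≠ 0 := fun h => hi (by simp [h])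
    have h0 : 0 ≤ i := by
      by_contra h
      exact hfi (hneg i (by omega))
    lift i to ℕ using h0
    rw [hpos] at hfi
    simpa using hfi

theorem finsum_mul_eq_zero_of_neg {f g : ℤ → R} (hf : ∀ n : ℕ, f n = 0) (hg : ∀ n : ℕ, g n = 0)
    (n : ℕ) : ∑ᶠ i : ℤ, f i * g (n - i) = 0 := by
  refine finsum_eq_zero_of_forall_eq_zero fun i => ?_
  rcases lt_or_ge i 0 with h | h
  · obtain ⟨m, hm⟩ := Int.eq_ofNat_of_zero_le (show 0 ≤ (n : ℤ) - i by omega)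
    rw [hm]
    simp [hg]
  · lift i to ℕ using h
    simp [hf]

theorem finsum_mul_eq_sum_range_of_neg {f g : ℤ → R} (hf : ∀ n : ℕ, f n = 0)
    (hg : ∀ n : ℕ, g n = 0) (k : ℕ) :
    ∑ᶠ i : ℤ, f i * g (-(k : ℤ) - 1 - i) =
      ∑ j ∈ Finset.range k, f (-(j : ℤ) - 1) * g (-((k - 1 - j : ℕ) : ℤ) - 1) := by
  have hinj : Function.Injective fun j : ℕ => -(j : ℤ) - 1 := fun a b h => by
    simp only at h; omega
  rw [finsum_eq_sum_of_support_subset (s := (Finset.range k).map ⟨_, hinj⟩), Finset.sum_map]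
  · refine Finset.sum_congr rfl fun j hj => ?_
    have := Finset.mem_range.mp hj
    simp only [Function.Embedding.coeFn_mk]
    congr 2
    omega
  · intro i hi
    have hfi : f i ≠ 0 := fun h => hi (by simp [h])
    have hgi : g (-(k : ℤ) - 1 - i) ≠ 0 := fun h => hi (by simp [h])
    have h1 : i < 0 := by
      by_contra h
      exact hfi (by rw [← Int.toNat_of_nonneg (show 0 ≤ i by omega)]; exact hf _)
    have h2 : -(k : ℤ) - 1 - i < 0 := by
      by_contra h
      exact hgi (by
        rw [← Int.toNat_of_nonneg (show 0 ≤ -(k : ℤ) - 1 - i by omega)]; exact hg _)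
    simp only [Finset.coe_map, Function.Embedding.coeFn_mk, Set.mem_image, Finset.mem_coe,
      Finset.mem_range]
    exact ⟨(-i - 1).toNat, by omega, by omega⟩

/-- Splitting off the polynomial parts of both factors in a product of Laurent series. -/
theorem lmul_apply_eq_add {Q Q' : ↥(IntBdd R R)} {P P' : R[X]}
    (hP : ∀ n : ℕ, Q.1 n = P.coeff n) (hP' : ∀ n : ℕ, Q'.1 n = P'.coeff n) (n : ℤ) :
    (lmul Q Q').1 n = coeffSum (fun i : ℕ => Q'.1 (n - i)) P
      + coeffSum (fun i : ℕ => if n - i < 0 then Q.1 (n - i) else 0) P'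
      + ∑ᶠ i : ℤ, (if i < 0 then Q.1 i else 0) * (if n - i < 0 then Q'.1 (n - i) else 0) := by
  obtain ⟨N, hN⟩ := Q.2
  obtain ⟨K, hK⟩ := Q'.2
  have key : ∀ f g : ℤ → R, (∀ i, N < i → f i = 0) → (∀ i, K < i → g i = 0) →
      (Function.support fun i => f i * g (n - i)).Finite := by
    intro f g hf hg
    refine (Set.finite_Icc (n - K) N).subset fun i hi => ⟨?_, ?_⟩
    · by_contra h
      exact hi (by simp [hg (n - i) (by omega)])
    · by_contra h
      exact hi (by simp [hf i (by omega)])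
  have hneg : ∀ i, N < i → (if i < 0 then Q.1 i else 0) = 0 := fun i hi => by simp [hN i hi]
  have hneg' : ∀ i, K < i → (if i < 0 then Q'.1 i else 0) = 0 := fun i hi => by simp [hK i hi]
  have hpos : ∀ i, N < i → (if i < 0 then 0 else Q.1 i) = 0 := fun i hi => by simp [hN i hi]
  have hpos' : ∀ i, K < i → (if i < 0 then 0 else Q'.1 i) = 0 := fun i hi => by simp [hK i hi]
  have e1 : (lmul Q Q').1 n = ∑ᶠ i : ℤ, (if i < 0 then 0 else Q.1 i) * Q'.1 (n - i)
      + ∑ᶠ i : ℤ, (if i < 0 then Q.1 i else 0) * Q'.1 (n - i) := by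
    rw [← finsum_add_distrib (key (fun i => if i < 0 then 0 else Q.1 i) _ hpos hK)
      (key (fun i => if i < 0 then Q.1 i else 0) _ hneg hK)]
    refine finsum_congr fun i => ?_
    split_ifs <;> simp
  have e2 : ∑ᶠ i : ℤ, (if i < 0 then Q.1 i else 0) * Q'.1 (n - i)
      = ∑ᶠ i : ℤ, (if i < 0 then Q.1 i else 0) * (if n - i < 0 then 0 else Q'.1 (n - i))
      + ∑ᶠ i : ℤ, (if i < 0 then Q.1 i else 0) * (if n - i < 0 then Q'.1 (n - i) else 0) := by
    rw [← finsum_add_distrib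
      (key (fun i => if i < 0 then Q.1 i else 0) (fun i => if i < 0 then 0 else Q'.1 i) hneg hpos')
      (key (fun i => if i < 0 then Q.1 i else 0) (fun i => if i < 0 then Q'.1 i else 0) hneg hneg')]
    refine finsum_congr fun i => ?_
    split_ifs <;> simp
  have e3 : ∑ᶠ i : ℤ, (if i < 0 then Q.1 i else 0) * (if n - i < 0 then 0 else Q'.1 (n - i))
      = ∑ᶠ i : ℤ, (if i < 0 then 0 else Q'.1 i) * (if n - i < 0 then Q.1 (n - i) else 0) := by
    rw [← finsum_comp_equiv (Equiv.subLeft n)]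
    refine finsum_congr fun i => ?_
    simp only [Equiv.subLeft_apply, sub_sub_cancel]
    exact mul_comm _ _
  rw [e1, e2, e3, finsum_mul_eq_coeffSum (f := fun i => if i < 0 then 0 else Q.1 i) (P := P)
      (fun n => by simp [hP]) (fun n hn => by simp [hn]) Q'.1,
    finsum_mul_eq_coeffSum (f := fun i => if i < 0 then 0 else Q'.1 i) (P := P')
      (fun n => by simp [hP']) (fun n hn => by simp [hn]) (fun i => if i < 0 then Q.1 i else 0),
    add_assoc]

theorem coeffSum_laurent {g : ℤ → R} {P' : R[X]} {c : ℕ → R} (hP' : ∀ n : ℕ, g n = P'.coeff n)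
    (hc : ∀ k : ℕ, g (-(k : ℤ) - 1) = c k) (P : R[X]) (n : ℕ) :
    coeffSum (fun i : ℕ => g (n - i)) P = (P * P' + polyPart c P).coeff n := by
  induction P using induction_X_pow with
  | add P S hP hS => simp only [map_add, hP, hS, add_mul, coeff_add]; ring
  | smul a P hP => simp only [map_smul, hP, smul_mul_assoc, coeff_add, coeff_smul, smul_add]
  | X_pow m =>
    rw [coeffSum_X_pow, coeff_add, coeff_X_pow_mul', coeff_polyPart_X_pow]
    split_ifs with h1 h2 h2
    · omega
    · rw [add_zero, ← hP', Nat.cast_sub h1]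
    · rw [zero_add, ← hc]
      congr 1
      omega
    · omega

theorem lmul_apply_natCast {Q Q' : ↥(IntBdd R R)} {P P' : R[X]} {c c' : ℕ → R}
    (hP : ∀ n : ℕ, Q.1 n = P.coeff n) (hP' : ∀ n : ℕ, Q'.1 n = P'.coeff n)
    (hc : ∀ k : ℕ, Q.1 (-(k : ℤ) - 1) = c k) (hc' : ∀ k : ℕ, Q'.1 (-(k : ℤ) - 1) = c' k) (n : ℕ) :
    (lmul Q Q').1 n = (P * P' + polyPart c' P + polyPart c P').coeff n := by
  rw [lmul_apply_eq_add hP hP', finsum_mul_eq_zero_of_neg (f := fun i => if i < 0 then Q.1 i else 0)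
    (g := fun i => if i < 0 then Q'.1 i else 0) (by simp) (by simp), add_zero, coeff_add]
  congr 1
  · exact coeffSum_laurent hP' hc' P n
  · simpa using coeffSum_laurent (g := fun i => if i < 0 then Q.1 i else 0) (P' := 0) (c := c)
      (by simp) (fun k => by rw [if_pos (by omega), hc]) P' n

theorem lmul_apply_neg {Q Q' : ↥(IntBdd R R)} {P P' : R[X]} {c c' : ℕ → R}
    (hP : ∀ n : ℕ, Q.1 n = P.coeff n) (hP' : ∀ n : ℕ, Q'.1 n = P'.coeff n)
    (hc : ∀ k : ℕ, Q.1 (-(k : ℤ) - 1) = c k) (hc' : ∀ k : ℕ, Q'.1 (-(k : ℤ) - 1) = c' k) (k : ℕ) :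
    (lmul Q Q').1 (-(k : ℤ) - 1) = coeffSum (fun i => c' (k + i)) P
      + coeffSum (fun i => c (k + i)) P' + ∑ j ∈ Finset.range k, c j * c' (k - 1 - j) := by
  rw [lmul_apply_eq_add hP hP', finsum_mul_eq_sum_range_of_neg
    (f := fun i => if i < 0 then Q.1 i else 0)
    (g := fun i => if i < 0 then Q'.1 i else 0) (by simp) (by simp)]
  have hsub : ∀ i : ℕ, -(k : ℤ) - 1 - i = -((k + i : ℕ) : ℤ) - 1 := fun i => by push_cast; ring
  have hlt : ∀ i : ℕ, -(i : ℤ) - 1 < 0 := fun i => by omega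
  simp only [hsub, hlt, if_true, hc, hc']

end Laurent

namespace SComplexData

open Polynomial TensorProduct

variable {R : Type u} [CommRing R]

section Basic

variable {X : SComplexData R}

theorem δ₂_apply (X : SComplexData R) (r : R) : X.δ₂ r = r • X.δ₂ 1 := by
  rw [← map_smul, smul_eq_mul, mul_one]

theorem sumV_eq_aeval {f : ↥(NatBdd R R)} {P : R[X]} (h : ∀ n, f.1 n = P.coeff n) :
    X.sumV f = aeval X.v P (X.δ₂ 1) := by
  rw [sumV, finsum_eq_sum_of_support_subset (s := Finset.range (P.natDegree + 1)),
    aeval_eq_sum_range, LinearMap.sum_apply]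
  · refine Finset.sum_congr rfl fun i _ => ?_
    rw [δ₂_apply, map_smul, h, LinearMap.smul_apply]
  · intro i hi
    by_contra hne
    rw [Finset.coe_range, Set.mem_Iio, not_lt] at hne
    exact hi (by simp [h, coeff_eq_zero_of_natDegree_lt (Nat.lt_of_succ_le hne)])

/-- A description of `𝔍` in terms of polynomials. -/
theorem mem_JJ_iff {Q : ↥(IntBdd R R)} : Q ∈ X.JJ ↔ ∃ (α : X.Tot) (P : R[X]),
    X.d α = aeval X.v P (X.δ₂ 1) ∧ (∀ n : ℕ, Q.1 n = P.coeff n) ∧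
      ∀ k : ℕ, Q.1 (-(k : ℤ) - 1) = X.δ₁ ((X.v ^ k) α) := by
  constructor
  · rintro ⟨⟨α, p⟩, hd, rfl⟩
    obtain ⟨N, hN⟩ := p.2
    have hp : ∀ n, p.1 n = (∑ i ∈ Finset.range (N + 1), monomial i (p.1 i)).coeff n := by
      intro n
      simp only [finsetSum_coeff, coeff_monomial, Finset.sum_ite_eq', Finset.mem_range]
      split_ifs with h
      · rfl
      · exact hN n (by omega)
    refine ⟨α, _, ?_, hp, fun k => ?_⟩
    · rw [← sumV_eq_aeval hp]
      exact sub_eq_zero.mp (congrArg Prod.fst hd)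
    · simp only [iota]
      rw [if_pos (by omega)]
      congr 3
      omega
  · rintro ⟨α, P, hd, hpos, hneg⟩
    refine ⟨(α, ⟨P.coeff, P.natDegree, fun n hn => coeff_eq_zero_of_natDegree_lt hn⟩), ?_, ?_⟩
    · refine Prod.ext ?_ rfl
      change X.d α - X.sumV _ = 0
      rw [sumV_eq_aeval (P := P) fun n => rfl, hd, sub_self]
    · refine Subtype.ext (funext fun n => ?_)
      simp only [iota]
      split_ifs with h
      · rw [← hneg, show -((-n - 1).toNat : ℤ) - 1 = n by omega]
      · rw [← hpos, Int.toNat_of_nonneg (by omega)]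

namespace IsSComplex

theorem d_v_apply (hX : X.IsSComplex) (x : X.Tot) :
    X.d (X.v x) = X.v (X.d x) + X.δ₁ x • X.δ₂ 1 := by
  have h := LinearMap.congr_fun hX.d_v x
  simp only [LinearMap.sub_apply, LinearMap.comp_apply, LinearMap.zero_apply] at h
  rw [← δ₂_apply, ← sub_eq_zero, ← h]
  abel

theorem d_aeval (hX : X.IsSComplex) (P : R[X]) (x : X.Tot) :
    X.d (aeval X.v P x) = aeval X.v P (X.d x) +
      aeval X.v (polyPart (fun l => X.δ₁ ((X.v ^ l) x)) P) (X.δ₂ 1) := by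
  induction P using induction_X_pow with
  | add P Q hP hQ => simp only [map_add, LinearMap.add_apply, hP, hQ]; abel
  | smul a P hP => simp only [map_smul, LinearMap.smul_apply, hP, smul_add]
  | X_pow n =>
    induction n with
    | zero => simp
    | succ n ih =>
      rw [polyPart_X_pow_succ, pow_succ', map_mul, Module.End.mul_apply, aeval_X, hX.d_v_apply, ih]
      simp only [map_mul, map_add, aeval_X, Module.End.mul_apply, map_smul,
        map_one, LinearMap.add_apply, LinearMap.smul_apply, Module.End.one_apply, map_pow]
      abel

theorem hom_ext (hX : X.IsSComplex) {M : Type*} [AddCommGroup M] [Module R M]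
    {f g : X.Tot →ₗ[R] M} (h : ∀ i, ∀ x ∈ X.grading i, f x = g x) : f = g := by
  ext x
  have hx : x ∈ ⨆ i, X.grading i := by
    rw [hX.internal.submodule_iSup_eq_top]; trivial
  induction hx using Submodule.iSup_induction' with
  | mem i x hx => exact h i x hx
  | zero => simp
  | add x y _ _ hx hy => rw [map_add, map_add, hx, hy]

theorem d_mem (hX : X.IsSComplex) {i : ℤ} {x : X.Tot} (hx : x ∈ X.grading i) :
    X.d x ∈ X.grading (i - 1) :=
  hX.d_deg i (Submodule.mem_map_of_mem hx)

theorem v_pow_mem (hX : X.IsSComplex) {i : ℤ} {x : X.Tot} (hx : x ∈ X.grading i) (k : ℕ) :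
    (X.v ^ k) x ∈ X.grading (i - 2 * k) := by
  induction k with
  | zero => simpa using hx
  | succ k ih =>
    rw [pow_succ', Module.End.mul_apply]
    have := hX.v_deg _ (Submodule.mem_map_of_mem ih)
    convert this using 2
    push_cast
    ring

theorem δ₂_mem (hX : X.IsSComplex) (r : R) : X.δ₂ r ∈ X.grading (-2) :=
  hX.δ₂_deg (LinearMap.mem_range_self _ _)

theorem δ₁_v_pow_δ₂ (hX : X.IsSComplex) (k : ℕ) (r : R) : X.δ₁ ((X.v ^ k) (X.δ₂ r)) = 0 :=
  hX.δ₁_deg _ (by omega) _ (hX.v_pow_mem (hX.δ₂_mem r) k)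

theorem d_v_pow_δ₂ (hX : X.IsSComplex) (k : ℕ) (r : R) : X.d ((X.v ^ k) (X.δ₂ r)) = 0 := by
  induction k with
  | zero => exact LinearMap.congr_fun hX.d_δ₂ r
  | succ k ih =>
    rw [pow_succ', Module.End.mul_apply, hX.d_v_apply, ih, hX.δ₁_v_pow_δ₂]
    simp

theorem commute_sign_v (hX : X.IsSComplex) : Commute X.sign X.v := by
  refine hX.hom_ext fun i x hx => ?_
  rw [Module.End.mul_apply, Module.End.mul_apply, hX.sign_spec i x hx,
    hX.sign_spec (i - 2) _ (by simpa using hX.v_pow_mem hx 1)]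
  simp only [Int.even_sub, even_two, iff_true]
  split_ifs <;> simp

theorem sign_v_pow (hX : X.IsSComplex) (k : ℕ) (x : X.Tot) :
    X.sign ((X.v ^ k) x) = (X.v ^ k) (X.sign x) :=
  LinearMap.congr_fun (hX.commute_sign_v.pow_right k) x

theorem sign_aeval (hX : X.IsSComplex) (P : R[X]) (x : X.Tot) :
    X.sign (aeval X.v P x) = aeval X.v P (X.sign x) := by
  induction P using induction_X_pow with
  | add P Q hP hQ => simp only [map_add, LinearMap.add_apply, hP, hQ]
  | smul a P hP => simp only [map_smul, LinearMap.smul_apply, hP]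
  | X_pow n => simpa using hX.sign_v_pow n x

theorem sign_δ₂ (hX : X.IsSComplex) (r : R) : X.sign (X.δ₂ r) = X.δ₂ r := by
  rw [hX.sign_spec _ _ (hX.δ₂_mem r), if_pos (by decide)]

/-- The projection to the odd part of an S-complex. -/
theorem exists_odd_proj (hX : X.IsSComplex) : ∃ π : X.Tot →ₗ[R] X.Tot,
    ∀ i, ∀ x ∈ X.grading i, π x = if Even i then 0 else x := by
  let e := LinearEquiv.ofBijective (DirectSum.coeLinearMap X.grading) hX.internal
  refine ⟨DirectSum.toModule R ℤ X.Tot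
    (fun i => if Even i then 0 else (X.grading i).subtype) ∘ₗ e.symm.toLinearMap, fun i x hx => ?_⟩
  have : e.symm x = DirectSum.lof R ℤ (fun i => X.grading i) i ⟨x, hx⟩ := by
    rw [LinearEquiv.symm_apply_eq]
    exact (DirectSum.coeLinearMap_lof X.grading i ⟨x, hx⟩).symm
  rw [LinearMap.comp_apply, LinearEquiv.coe_coe, this, DirectSum.toModule_lof]
  split_ifs <;> rfl

/-- Cycles of the small complex can be replaced by odd ones with the same Laurent series. -/
theorem exists_odd (hX : X.IsSComplex) {P : R[X]} {α : X.Tot}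
    (h : X.d α = aeval X.v P (X.δ₂ 1)) : ∃ β : X.Tot, X.sign β = -β ∧
      X.d β = aeval X.v P (X.δ₂ 1) ∧ ∀ k : ℕ, X.δ₁ ((X.v ^ k) β) = X.δ₁ ((X.v ^ k) α) := by
  obtain ⟨π, hπ⟩ := hX.exists_odd_proj
  have hsign : X.sign ∘ₗ π = -π := hX.hom_ext fun i x hx => by
    rw [LinearMap.comp_apply, LinearMap.neg_apply, hπ i x hx]
    split_ifs with hi
    · simp
    · rw [hX.sign_spec i x hx, if_neg hi]
  have hd : X.d ∘ₗ π = X.d - π ∘ₗ X.d := hX.hom_ext fun i x hx => by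
    rw [LinearMap.comp_apply, LinearMap.sub_apply, LinearMap.comp_apply, hπ i x hx,
      hπ _ _ (hX.d_mem hx)]
    by_cases hi : Even i <;> simp only [hi, Int.even_sub, Int.not_even_one] <;> simp
  have hδ : ∀ k : ℕ, X.δ₁ ∘ₗ (X.v ^ k) ∘ₗ π = X.δ₁ ∘ₗ (X.v ^ k) := fun k =>
    hX.hom_ext fun i x hx => by
      rw [LinearMap.comp_apply, LinearMap.comp_apply, LinearMap.comp_apply, hπ i x hx]
      split_ifs with hi
      · rw [map_zero, map_zero, hX.δ₁_deg _ _ _ (hX.v_pow_mem hx k)]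
        intro h
        obtain ⟨m, rfl⟩ := hi
        omega
      · rfl
  have hπ₂ : ∀ P : R[X], π (aeval X.v P (X.δ₂ 1)) = 0 := fun P => by
    induction P using induction_X_pow with
    | add P Q hP hQ => simp only [map_add, LinearMap.add_apply, hP, hQ, add_zero]
    | smul a P hP => simp only [map_smul, LinearMap.smul_apply, hP, smul_zero]
    | X_pow n =>
      rw [map_pow, aeval_X, hπ _ _ (hX.v_pow_mem (hX.δ₂_mem 1) n), if_pos]
      exact ⟨-1 - n, by ring⟩
  refine ⟨π α, LinearMap.congr_fun hsign α, ?_, fun k => LinearMap.congr_fun (hδ k) α⟩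
  have := LinearMap.congr_fun hd α
  rw [LinearMap.comp_apply, LinearMap.sub_apply, LinearMap.comp_apply, h, hπ₂, sub_zero] at this
  exact this

end IsSComplex

theorem δ₁_v_pow_aeval (k : ℕ) (P : R[X]) (x : X.Tot) :
    X.δ₁ ((X.v ^ k) (aeval X.v P x)) = coeffSum (fun i => X.δ₁ ((X.v ^ (k + i)) x)) P := by
  induction P using induction_X_pow with
  | add P Q hP hQ => simp only [map_add, LinearMap.add_apply, hP, hQ]
  | smul r P hP => simp only [map_smul, LinearMap.smul_apply, hP]
  | X_pow n => rw [coeffSum_X_pow, map_pow, aeval_X, ← Module.End.mul_apply, ← pow_add]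

end Basic

section Tensor

variable {A B : SComplexData R}

/-- The endomorphism `v ⊗ 1` of the tensor product. -/
noncomputable abbrev vLeft (A B : SComplexData R) : Module.End R (A.Tot ⊗[R] B.Tot) :=
  TensorProduct.map A.v LinearMap.id

/-- The endomorphism `1 ⊗ v` of the tensor product, with `v` acting on the second factor. -/
noncomputable abbrev vRight (A B : SComplexData R) : Module.End R (A.Tot ⊗[R] B.Tot) :=
  TensorProduct.map LinearMap.id B.v

theorem commute_vLeft_vRight : Commute (vLeft A B) (vRight A B) :=
  TensorProduct.ext' fun _ _ => rfl

theorem vLeft_pow_tmul (n : ℕ) (a : A.Tot) (b : B.Tot) :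
    (vLeft A B ^ n) (a ⊗ₜ[R] b) = (A.v ^ n) a ⊗ₜ[R] b := by
  induction n with
  | zero => rfl
  | succ n ih => rw [pow_succ', pow_succ', Module.End.mul_apply, ih]; rfl

theorem vRight_pow_tmul (n : ℕ) (a : A.Tot) (b : B.Tot) :
    (vRight A B ^ n) (a ⊗ₜ[R] b) = a ⊗ₜ[R] (B.v ^ n) b := by
  induction n with
  | zero => rfl
  | succ n ih => rw [pow_succ', pow_succ', Module.End.mul_apply, ih]; rfl

theorem aeval_vLeft_tmul (P : R[X]) (a : A.Tot) (b : B.Tot) :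
    aeval (vLeft A B) P (a ⊗ₜ[R] b) = aeval A.v P a ⊗ₜ[R] b := by
  induction P using induction_X_pow with
  | add P Q hP hQ => simp only [map_add, LinearMap.add_apply, hP, hQ, add_tmul]
  | smul r P hP => simp only [map_smul, LinearMap.smul_apply, hP, smul_tmul']
  | X_pow n => simp only [map_pow, aeval_X, vLeft_pow_tmul]

theorem aeval_vRight_tmul (P : R[X]) (a : A.Tot) (b : B.Tot) :
    aeval (vRight A B) P (a ⊗ₜ[R] b) = a ⊗ₜ[R] aeval B.v P b := by
  induction P using induction_X_pow with
  | add P Q hP hQ => simp only [map_add, LinearMap.add_apply, hP, hQ, tmul_add]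
  | smul r P hP => simp only [map_smul, LinearMap.smul_apply, hP, tmul_smul]
  | X_pow n => simp only [map_pow, aeval_X, vRight_pow_tmul]

/-- The divided difference of a polynomial at `vLeft` and `vRight`. -/
noncomputable abbrev vDiff (A B : SComplexData R) : R[X] →ₗ[R] Module.End R (A.Tot ⊗[R] B.Tot) :=
  divDiff (vLeft A B) (vRight A B)

theorem vDiff_X_pow_tmul (n : ℕ) (a : A.Tot) (b : B.Tot) :
    vDiff A B (X ^ n) (a ⊗ₜ[R] b) =
      ∑ i ∈ Finset.range n, (A.v ^ i) a ⊗ₜ[R] (B.v ^ (n - 1 - i)) b := by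
  rw [divDiff_X_pow, LinearMap.sum_apply]
  simp only [Module.End.mul_apply, vRight_pow_tmul, vLeft_pow_tmul]

theorem dTensor_vDiff_left (hA : A.IsSComplex) (hB : B.IsSComplex) (P : R[X]) (β : B.Tot) :
    (TensorProduct.map A.d LinearMap.id + TensorProduct.map A.sign B.d :
      Module.End R (A.Tot ⊗[R] B.Tot))
        (vDiff A B P (A.δ₂ 1 ⊗ₜ β)) =
      vDiff A B P (A.δ₂ 1 ⊗ₜ B.d β) +
        vDiff A B (polyPart (fun l => B.δ₁ ((B.v ^ l) β)) P) (A.δ₂ 1 ⊗ₜ B.δ₂ 1) := by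
  induction P using induction_X_pow with
  | add P Q hP hQ =>
    rw [map_add (vDiff A B), LinearMap.add_apply (vDiff A B P), map_add, hP, hQ]
    simp only [map_add, LinearMap.add_apply]; abel
  | smul r P hP =>
    rw [map_smul, LinearMap.smul_apply, map_smul, hP]
    simp only [map_smul, LinearMap.smul_apply, smul_add]
  | X_pow n =>
    rw [vDiff_X_pow_tmul, vDiff_X_pow_tmul, divDiff_polyPart_X_pow, LinearMap.sum_apply, map_sum,
      ← Finset.sum_add_distrib]
    refine Finset.sum_congr rfl fun i _ => ?_
    have := hB.d_aeval (X ^ (n - 1 - i)) β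
    simp only [map_pow, aeval_X] at this
    simp only [LinearMap.add_apply, TensorProduct.map_tmul, hA.d_v_pow_δ₂, zero_tmul, zero_add,
      hA.sign_v_pow, hA.sign_δ₂, Module.End.mul_apply, aeval_vRight_tmul, vLeft_pow_tmul, this,
      tmul_add]

theorem dTensor_vDiff_right (hA : A.IsSComplex) (hB : B.IsSComplex) (P : R[X]) (α : A.Tot) :
    (TensorProduct.map A.d LinearMap.id + TensorProduct.map A.sign B.d :
      Module.End R (A.Tot ⊗[R] B.Tot))
        (vDiff A B P (α ⊗ₜ B.δ₂ 1)) =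
      vDiff A B P (A.d α ⊗ₜ B.δ₂ 1) +
        vDiff A B (polyPart (fun l => A.δ₁ ((A.v ^ l) α)) P) (A.δ₂ 1 ⊗ₜ B.δ₂ 1) := by
  induction P using induction_X_pow with
  | add P Q hP hQ =>
    rw [map_add (vDiff A B), LinearMap.add_apply (vDiff A B P), map_add, hP, hQ]
    simp only [map_add, LinearMap.add_apply]; abel
  | smul r P hP =>
    rw [map_smul, LinearMap.smul_apply, map_smul, hP]
    simp only [map_smul, LinearMap.smul_apply, smul_add]
  | X_pow n =>
    rw [vDiff_X_pow_tmul, vDiff_X_pow_tmul, divDiff_polyPart_X_pow', LinearMap.sum_apply, map_sum,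
      ← Finset.sum_add_distrib]
    refine Finset.sum_congr rfl fun i _ => ?_
    have := hA.d_aeval (X ^ i) α
    simp only [map_pow, aeval_X] at this
    simp only [LinearMap.add_apply, TensorProduct.map_tmul, hB.d_v_pow_δ₂, tmul_zero, add_zero,
      Module.End.mul_apply, aeval_vLeft_tmul, vRight_pow_tmul, this, add_tmul, LinearMap.id_apply]

theorem rid_sign_δ₁_vDiff_left (hA : A.IsSComplex) (P : R[X]) (β : B.Tot) :
    TensorProduct.rid R A.Tot (TensorProduct.map A.sign B.δ₁ (vDiff A B P (A.δ₂ 1 ⊗ₜ β))) =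
      aeval A.v (polyPart (fun l => B.δ₁ ((B.v ^ l) β)) P) (A.δ₂ 1) := by
  induction P using induction_X_pow with
  | add P Q hP hQ => simp only [map_add, LinearMap.add_apply, hP, hQ]
  | smul r P hP => simp only [map_smul, LinearMap.smul_apply, hP]
  | X_pow n =>
    rw [vDiff_X_pow_tmul, polyPart_X_pow, ← Finset.sum_range_reflect]
    simp only [map_sum, TensorProduct.map_tmul, rid_tmul, hA.sign_v_pow, hA.sign_δ₂,
      LinearMap.sum_apply, map_smul, map_pow, aeval_X, LinearMap.smul_apply]
    refine Finset.sum_congr rfl fun i hi => ?_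
    have := Finset.mem_range.mp hi
    rw [show n - 1 - (n - 1 - i) = i by omega]

theorem rid_sign_δ₁_vDiff_right (hB : B.IsSComplex) (P : R[X]) (α : A.Tot) :
    TensorProduct.rid R A.Tot (TensorProduct.map A.sign B.δ₁ (vDiff A B P (α ⊗ₜ B.δ₂ 1))) = 0 := by
  induction P using induction_X_pow with
  | add P Q hP hQ => simp only [map_add, LinearMap.add_apply, hP, hQ, add_zero]
  | smul r P hP => simp only [map_smul, LinearMap.smul_apply, hP, smul_zero]
  | X_pow n =>
    rw [vDiff_X_pow_tmul]
    simp [hB.δ₁_v_pow_δ₂]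

theorem lid_δ₁_vDiff_left (hA : A.IsSComplex) (P : R[X]) (β : B.Tot) :
    TensorProduct.lid R B.Tot
      (TensorProduct.map A.δ₁ LinearMap.id (vDiff A B P (A.δ₂ 1 ⊗ₜ β))) = 0 := by
  induction P using induction_X_pow with
  | add P Q hP hQ => simp only [map_add, LinearMap.add_apply, hP, hQ, add_zero]
  | smul r P hP => simp only [map_smul, LinearMap.smul_apply, hP, smul_zero]
  | X_pow n =>
    rw [vDiff_X_pow_tmul]
    simp [hA.δ₁_v_pow_δ₂]

theorem lid_δ₁_vDiff_right (P : R[X]) (α : A.Tot) :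
    TensorProduct.lid R B.Tot
      (TensorProduct.map A.δ₁ LinearMap.id (vDiff A B P (α ⊗ₜ B.δ₂ 1))) =
      aeval B.v (polyPart (fun l => A.δ₁ ((A.v ^ l) α)) P) (B.δ₂ 1) := by
  induction P using induction_X_pow with
  | add P Q hP hQ => simp only [map_add, LinearMap.add_apply, hP, hQ]
  | smul r P hP => simp only [map_smul, LinearMap.smul_apply, hP]
  | X_pow n =>
    rw [vDiff_X_pow_tmul, polyPart_X_pow]
    simp

theorem sign_sub_vDiff_tmul (hA : A.IsSComplex) (P : R[X]) (a : A.Tot) (b : B.Tot) :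
    (TensorProduct.map A.sign B.v - TensorProduct.map (A.sign ∘ₗ A.v) LinearMap.id :
      Module.End R (A.Tot ⊗[R] B.Tot))
        (vDiff A B P (a ⊗ₜ b)) =
      A.sign a ⊗ₜ aeval B.v P b - aeval A.v P (A.sign a) ⊗ₜ b := by
  have h : (TensorProduct.map A.sign B.v - TensorProduct.map (A.sign ∘ₗ A.v) LinearMap.id :
      Module.End R (A.Tot ⊗[R] B.Tot)) =
      -(TensorProduct.map A.sign LinearMap.id * (vLeft A B - vRight A B)) := by
    refine TensorProduct.ext' fun x y => ?_
    simp
  rw [h, LinearMap.neg_apply, Module.End.mul_apply, ← Module.End.mul_apply (vLeft A B - _),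
    sub_mul_divDiff commute_vLeft_vRight, LinearMap.sub_apply, aeval_vLeft_tmul,
    aeval_vRight_tmul, map_sub, TensorProduct.map_tmul, TensorProduct.map_tmul, neg_sub,
    hA.sign_aeval, LinearMap.id_apply, LinearMap.id_apply]

theorem vDiff_mul_tmul (P P' : R[X]) (a : A.Tot) (b : B.Tot) :
    vDiff A B (P * P') (a ⊗ₜ b) =
      vDiff A B P (a ⊗ₜ aeval B.v P' b) + vDiff A B P' (aeval A.v P a ⊗ₜ b) := by
  have h : Commute (aeval (vLeft A B) P) (vDiff A B P') := by
    refine commute_divDiff ?_ ?_ P'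
    · simpa using (Commute.all P X).map (aeval (vLeft A B))
    · refine TensorProduct.ext' fun x y => ?_
      simp [aeval_vLeft_tmul]
  rw [divDiff_mul, h.eq, LinearMap.add_apply, Module.End.mul_apply, Module.End.mul_apply,
    aeval_vLeft_tmul, aeval_vRight_tmul]

theorem aeval_tensorS_v_δ₂ (P : R[X]) :
    aeval (tensorS A B).v P ((tensorS A B).δ₂ 1) =
      ((vDiff A B P (A.δ₂ 1 ⊗ₜ B.δ₂ 1), 0, aeval A.v P (A.δ₂ 1),
        aeval B.v P (B.δ₂ 1)) : TTen A B) := by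
  induction P using induction_X_pow with
  | add P Q hP hQ =>
    rw [map_add, LinearMap.add_apply, hP, hQ]
    simp only [map_add, LinearMap.add_apply]
    refine Prod.ext rfl (Prod.ext (add_zero _) rfl)
  | smul r P hP =>
    rw [map_smul, LinearMap.smul_apply, hP]
    simp only [map_smul, LinearMap.smul_apply]
    refine Prod.ext rfl (Prod.ext (smul_zero _) rfl)
  | X_pow n =>
    induction n with
    | zero =>
      simp
      rfl
    | succ n ih =>
      rw [pow_succ', map_mul, Module.End.mul_apply, ih, aeval_X, divDiff_X_mul]
      refine Prod.ext ?_ (Prod.ext ?_ (Prod.ext ?_ ?_))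
      · change vLeft A B _ + TensorProduct.map A.δ₂ LinearMap.id ((TensorProduct.lid R _).symm _) = _
        congr 1
        simp [tp4]
      · exact map_zero (vLeft A B)
      · change A.v _ = _
        simp [tp3]
      · change TensorProduct.lid R B.Tot (TensorProduct.map A.δ₁ LinearMap.id 0) + B.v _ = _
        simp [tp4]

theorem tensorS_v_apply (x y : A.Tot ⊗[R] B.Tot) (a : A.Tot) (b : B.Tot) :
    (tensorS A B).v ((x, y, a, b) : TTen A B) =
      ((vLeft A B x + TensorProduct.map A.δ₂ LinearMap.id ((TensorProduct.lid R B.Tot).symm b),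
        vLeft A B y, A.v a,
        TensorProduct.lid R B.Tot (TensorProduct.map A.δ₁ LinearMap.id y) + B.v b) : TTen A B) :=
  rfl

theorem tensorS_v_pow (k : ℕ) (x y : A.Tot ⊗[R] B.Tot) (a : A.Tot) (b : B.Tot) :
    ∃ z, ((tensorS A B).v ^ k) ((x, y, a, b) : TTen A B) =
      ((z, (vLeft A B ^ k) y, (A.v ^ k) a, (B.v ^ k) b +
        ∑ j ∈ Finset.range k, (B.v ^ (k - 1 - j)) (TensorProduct.lid R B.Tot
          (TensorProduct.map A.δ₁ LinearMap.id ((vLeft A B ^ j) y)))) : TTen A B) := by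
  induction k with
  | zero => exact ⟨x, by simp; rfl⟩
  | succ k ih =>
    obtain ⟨z, hz⟩ := ih
    have hk : ((tensorS A B).v ^ (k + 1)) ((x, y, a, b) : TTen A B) =
        (tensorS A B).v (((tensorS A B).v ^ k) ((x, y, a, b) : TTen A B)) := by
      rw [pow_succ']
      rfl
    refine ⟨vLeft A B z + TensorProduct.map A.δ₂ LinearMap.id ((TensorProduct.lid R B.Tot).symm
      ((B.v ^ k) b + ∑ j ∈ Finset.range k, (B.v ^ (k - 1 - j)) (TensorProduct.lid R B.Tot
        (TensorProduct.map A.δ₁ LinearMap.id ((vLeft A B ^ j) y))))),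
      hk.trans ((congrArg (tensorS A B).v hz).trans ((tensorS_v_apply _ _ _ _).trans ?_))⟩
    refine Prod.ext rfl (Prod.ext ?_ (Prod.ext ?_ ?_)) <;> dsimp only
    · rw [pow_succ', Module.End.mul_apply]
    · rw [pow_succ', Module.End.mul_apply]
    · rw [Finset.sum_range_succ, map_add, map_sum, pow_succ' B.v, Module.End.mul_apply, add_comm,
        add_assoc]
      congr 2
      · refine Finset.sum_congr rfl fun j hj => ?_
        have := Finset.mem_range.mp hj
        rw [← Module.End.mul_apply, ← pow_succ', show k + 1 - 1 - j = k - 1 - j + 1 by omega]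
      · simp

theorem tensorS_d_eq (hA : A.IsSComplex) (hB : B.IsSComplex) {P P' : R[X]} {α : A.Tot} {β : B.Tot}
    (hα : A.sign α = -α) (hdα : A.d α = aeval A.v P (A.δ₂ 1))
    (hdβ : B.d β = aeval B.v P' (B.δ₂ 1)) :
    (tensorS A B).d ((vDiff A B P (A.δ₂ 1 ⊗ₜ β) + vDiff A B P' (α ⊗ₜ B.δ₂ 1), α ⊗ₜ β, aeval A.v P' α,
        aeval B.v P β) : TTen A B) =
      aeval (tensorS A B).v (P * P' + polyPart (fun l => B.δ₁ ((B.v ^ l) β)) P +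
        polyPart (fun l => A.δ₁ ((A.v ^ l) α)) P') ((tensorS A B).δ₂ 1) := by
  rw [aeval_tensorS_v_δ₂]
  refine Prod.ext ?_ (Prod.ext ?_ (Prod.ext ?_ ?_))
  · change (TensorProduct.map A.d LinearMap.id + TensorProduct.map A.sign B.d :
      Module.End R (A.Tot ⊗[R] B.Tot)) (_ + _) = _
    rw [map_add, dTensor_vDiff_left hA hB, dTensor_vDiff_right hA hB, hdα, hdβ]
    simp only [map_add, LinearMap.add_apply, vDiff_mul_tmul]
    abel
  · change (TensorProduct.map A.sign B.v - TensorProduct.map (A.sign ∘ₗ A.v) LinearMap.id :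
      Module.End R (A.Tot ⊗[R] B.Tot)) (_ + _)
      + (TensorProduct.map A.d LinearMap.id - TensorProduct.map A.sign B.d :
      Module.End R (A.Tot ⊗[R] B.Tot)) (α ⊗ₜ β)
      + TensorProduct.map A.sign B.δ₂ ((TensorProduct.rid R A.Tot).symm (aeval A.v P' α))
      - TensorProduct.map A.δ₂ LinearMap.id ((TensorProduct.lid R B.Tot).symm (aeval B.v P β)) = 0
    rw [map_add, sign_sub_vDiff_tmul hA, sign_sub_vDiff_tmul hA]
    simp only [LinearMap.sub_apply, TensorProduct.map_tmul, TensorProduct.rid_symm_apply,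
      TensorProduct.lid_symm_apply, hA.sign_aeval, hA.sign_δ₂, hα, hdα, hdβ, map_neg, neg_tmul,
      LinearMap.id_apply]
    abel
  · change TensorProduct.rid R A.Tot (TensorProduct.map A.sign B.δ₁ (_ + _))
      + A.d (aeval A.v P' α) = _
    rw [map_add, map_add, rid_sign_δ₁_vDiff_left hA, rid_sign_δ₁_vDiff_right hB, hA.d_aeval, hdα]
    simp only [map_add, LinearMap.add_apply, mul_comm P P', map_mul, Module.End.mul_apply]
    abel
  · change TensorProduct.lid R B.Tot (TensorProduct.map A.δ₁ LinearMap.id (_ + _))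
      + B.d (aeval B.v P β) = _
    rw [map_add, map_add, lid_δ₁_vDiff_left hA, lid_δ₁_vDiff_right, hB.d_aeval, hdβ]
    simp only [map_add, LinearMap.add_apply, map_mul, Module.End.mul_apply]
    abel

end Tensor

end SComplexData

open SComplexData in
/-- **Statement 6.** Under the ring multiplication of `R[[x⁻¹, x]]` one has the
inclusion `𝔍(C̃)·𝔍(C̃') ⊆ 𝔍(C̃ ⊗ C̃')` for S-complexes over an integral domain. -/
theorem statement6 {R : Type u} [CommRing R] [IsDomain R]
    (A B : SComplexData R) (hA : A.IsSComplex) (hB : B.IsSComplex) :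
    ∀ Q ∈ A.JJ, ∀ Q' ∈ B.JJ, lmul Q Q' ∈ (tensorS A B).JJ := by
  intro Q hQ Q' hQ'
  obtain ⟨α₀, P, hdα₀, hP, hc₀⟩ := mem_JJ_iff.mp hQ
  obtain ⟨β₀, P', hdβ₀, hP', hc₀'⟩ := mem_JJ_iff.mp hQ'
  obtain ⟨α, hα, hdα, hc⟩ := hA.exists_odd hdα₀
  obtain ⟨β, -, hdβ, hc'⟩ := hB.exists_odd hdβ₀
  simp only [← hc] at hc₀
  simp only [← hc'] at hc₀'
  refine mem_JJ_iff.mpr ⟨_, _, tensorS_d_eq hA hB hα hdα hdβ,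
    lmul_apply_natCast hP hP' hc₀ hc₀', fun k => ?_⟩
  rw [lmul_apply_neg hP hP' hc₀ hc₀']
  obtain ⟨z, hz⟩ := tensorS_v_pow (A := A) (B := B) k _ _ _ _
  rw [hz]
  change _ = A.δ₁ ((A.v ^ k) _) + B.δ₁ ((B.v ^ k) _ + _)
  simp only [map_add, map_sum, δ₁_v_pow_aeval, vLeft_pow_tmul, TensorProduct.map_tmul,
    TensorProduct.lid_tmul, map_smul, smul_eq_mul, LinearMap.id_apply]
  ring
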